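/- arXiv:1902.07635 — 3 statements merged into one kernel-verified Lean document; each statement's English description precedes it below -/
import Mathlib

section
/- Let n ≥ 1, let c ∈ ℝ, let K₀, K₁,…,Kₙ : ℝ² → ℝ be twice continuously differentiable with compact support, and let Q : (ℝ²)^{n+1} → ℝ be bounded, continuous, and translation-invariant. Then for every w ∈ ℝ²: ∫_{(ℝ²)^{n+1}} Q(z₀,…,zₙ) K₀(z₀ − w) Σ_{i=1}^n (L_c K_i)(w − z_i) ∏_{k≠i} K_k(w − z_k) dz₀ ⋯ dzₙ = ∫_{(ℝ²)^{n+1}} Q(z₀,…,zₙ) (L_c K₀)(z₀ − w) ∏_{k=1}^n K_k(w − z_k) dz₀ ⋯ dzₙ + c ∫_{(ℝ²)^{n+1}} Q(z₀,…,zₙ) K₀(z₀ − w) Σ_{i≠j} (∂_x K_i)(w − z_i)(∂_x K_j)(w − z_j) ∏_{k∉{i,j}} K_k(w − z_k) dz₀ ⋯ dzₙ, where the last sum runs over all ordered pairs (i,j) with i ≠ j. -/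
open MeasureTheory Finset

/-- Partial derivative in the first ("time") coordinate of `ℝ × ℝ`. -/
noncomputable def pt (f : ℝ × ℝ → ℝ) (w : ℝ × ℝ) : ℝ := fderiv ℝ f w (1, 0)

/-- Partial derivative in the second ("space") coordinate of `ℝ × ℝ`. -/
noncomputable def px (f : ℝ × ℝ → ℝ) (w : ℝ × ℝ) : ℝ := fderiv ℝ f w (0, 1)

/-- The parabolic operator `L_c f = ∂_t f − c ∂_x² f`. -/
noncomputable def Lop (c : ℝ) (f : ℝ × ℝ → ℝ) : ℝ × ℝ → ℝ :=
  fun w => pt f w - c * px (px f) w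

/-- If `Q` is invariant along `v`, then `Q` integrates derivatives along `v` to zero. -/
theorem integral_mul_hasLineDerivAt_eq_zero {E : Type*} [NormedAddCommGroup E] [NormedSpace ℝ E]
    [MeasurableSpace E] [BorelSpace E] [FiniteDimensional ℝ E] {μ : Measure E}
    [μ.IsAddHaarMeasure] {Q G G' : E → ℝ} {v : E}
    (hQ : ∀ (x : E) (t : ℝ), Q (x + t • v) = Q x)
    (hG : Integrable (fun x => Q x * G x) μ) (hG' : Integrable (fun x => Q x * G' x) μ)
    (hd : ∀ x, HasLineDerivAt ℝ G (G' x) x v) :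
    ∫ x, Q x * G' x ∂μ = 0 := by
  have h := integral_bilinear_hasLineDerivAt_right_eq_neg_left_of_integrable (μ := μ)
    (f := Q) (f' := fun _ => 0) (g := G) (g' := G') (v := v) (B := ContinuousLinearMap.mul ℝ ℝ)
    (by simp) (by simpa using hG') (by simpa using hG)
    (fun x _ => by
      simp only [HasLineDerivAt, hQ]
      exact hasDerivAt_const _ _)
    (fun x _ => hd x)
  simpa using h

theorem integral_eq_add_const_mul_integral {α : Type*} [MeasurableSpace α] {μ : Measure α}
    {A B C T X Y : α → ℝ} (c : ℝ) (hB : Integrable B μ) (hC : Integrable C μ)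
    (hT : Integrable T μ) (hX : Integrable X μ) (hY : Integrable Y μ)
    (hT₀ : ∫ z, T z ∂μ = 0) (hX₀ : ∫ z, X z ∂μ = 0) (hY₀ : ∫ z, Y z ∂μ = 0)
    (h : ∀ z, A z = B z + c * C z - T z + c * (X z + Y z)) :
    ∫ z, A z ∂μ = ∫ z, B z ∂μ + c * ∫ z, C z ∂μ := by
  simp_rw [h]
  rw [integral_add (by fun_prop) (by fun_prop), integral_sub (by fun_prop) hT,
    integral_add hB (by fun_prop), integral_const_mul, integral_const_mul, integral_add hX hY,
    hT₀, hX₀, hY₀]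
  ring

theorem integrable_mul_prod {ι : Type*} [Fintype ι]
    {f : ℝ × ℝ → ℝ} {K : ι → ℝ × ℝ → ℝ}
    (hf : Integrable f) (hK : ∀ i, Integrable (K i)) (w : ℝ × ℝ) :
    Integrable fun z : (ℝ × ℝ) × (ι → ℝ × ℝ) =>
      f (z.1 - w) * ∏ k, K k (w - z.2 k) :=
  (hf.comp_sub_right w).mul_prod
    (Integrable.fintype_prod (f := fun k y => K k (w - y)) fun k => (hK k).comp_sub_left w)

theorem integrable_mul_sum_prod_erase {ι : Type*} [Fintype ι] [DecidableEq ι]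
    {f : ℝ × ℝ → ℝ} {K g : ι → ℝ × ℝ → ℝ}
    (hf : Integrable f) (hK : ∀ i, Integrable (K i)) (hg : ∀ i, Integrable (g i)) (w : ℝ × ℝ) :
    Integrable fun z : (ℝ × ℝ) × (ι → ℝ × ℝ) =>
      f (z.1 - w) * ∑ i, g i (w - z.2 i) * ∏ k ∈ univ.erase i, K k (w - z.2 k) := by
  simp only [mul_sum]
  refine integrable_finsetSum _ fun i _ => ?_
  refine (integrable_mul_prod (K := Function.update K i (g i)) hf (fun k => ?_) w).congr
    (.of_forall fun z => ?_)
  · rcases eq_or_ne k i with rfl | h <;> simp [*]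
  · dsimp only
    rw [← mul_prod_erase univ _ (mem_univ i), Function.update_self]
    congr 2
    refine prod_congr rfl fun k hk => ?_
    rw [Function.update_of_ne (ne_of_mem_erase hk)]

theorem integrable_mul_sum_sum_prod_erase {ι : Type*} [Fintype ι] [DecidableEq ι]
    {f : ℝ × ℝ → ℝ} {K g : ι → ℝ × ℝ → ℝ}
    (hf : Integrable f) (hK : ∀ i, Integrable (K i)) (hg : ∀ i, Integrable (g i)) (w : ℝ × ℝ) :
    Integrable fun z : (ℝ × ℝ) × (ι → ℝ × ℝ) =>
      f (z.1 - w) * ∑ i, ∑ j ∈ univ.erase i, g i (w - z.2 i) * g j (w - z.2 j)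
        * ∏ k ∈ (univ.erase i).erase j, K k (w - z.2 k) := by
  simp only [mul_sum]
  refine integrable_finsetSum _ fun i _ => integrable_finsetSum _ fun j hj => ?_
  refine (integrable_mul_prod (K := Function.update (Function.update K i (g i)) j (g j)) hf
    (fun k => ?_) w).congr (.of_forall fun z => ?_)
  · rcases eq_or_ne k j with rfl | h
    · simp [*]
    · rcases eq_or_ne k i with rfl | h' <;> simp [*]
  · dsimp only
    rw [← mul_prod_erase univ _ (mem_univ i), ← mul_prod_erase (univ.erase i) _ hj,
      Function.update_self, Function.update_of_ne (ne_of_mem_erase hj).symm,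
      Function.update_self, ← mul_assoc (g i _)]
    congr 2
    refine prod_congr rfl fun k hk => ?_
    rw [Function.update_of_ne (ne_of_mem_erase hk),
      Function.update_of_ne (ne_of_mem_erase (mem_of_mem_erase hk))]

theorem hasDerivAt_comp_add_smul_sub {f : ℝ × ℝ → ℝ} (hf : Differentiable ℝ f) (z w e : ℝ × ℝ) :
    HasDerivAt (fun t : ℝ => f (z + t • e - w)) (fderiv ℝ f (z - w) e) 0 := by
  have h : HasDerivAt (fun t : ℝ => z + t • e - w) e 0 := by
    simpa using (((hasDerivAt_id (0 : ℝ)).smul_const e).const_add z).sub_const w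
  have h' := (hf (z + (0 : ℝ) • e - w)).hasFDerivAt.comp_hasDerivAt (0 : ℝ) h
  simpa [Function.comp_def] using h'

theorem hasDerivAt_comp_sub_add_smul {f : ℝ × ℝ → ℝ} (hf : Differentiable ℝ f) (z w e : ℝ × ℝ) :
    HasDerivAt (fun t : ℝ => f (w - (z + t • e))) (-fderiv ℝ f (w - z) e) 0 := by
  have h : HasDerivAt (fun t : ℝ => w - (z + t • e)) (-e) 0 := by
    simpa using (((hasDerivAt_id (0 : ℝ)).smul_const e).const_add z).const_sub w
  have h' := (hf (w - (z + (0 : ℝ) • e))).hasFDerivAt.comp_hasDerivAt (0 : ℝ) h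
  simpa [Function.comp_def] using h'

theorem hasDerivAt_prod_comp_sub_add_smul {ι : Type*} [DecidableEq ι]
    {K : ι → ℝ × ℝ → ℝ} (hK : ∀ i, Differentiable ℝ (K i))
    (s : Finset ι) (z : ι → ℝ × ℝ) (w e : ℝ × ℝ) :
    HasDerivAt (fun t : ℝ => ∏ k ∈ s, K k (w - (z k + t • e)))
      (-∑ i ∈ s, fderiv ℝ (K i) (w - z i) e * ∏ k ∈ s.erase i, K k (w - z k)) 0 := by
  refine (HasDerivAt.fun_finsetProd
    fun i _ => hasDerivAt_comp_sub_add_smul (hK i) (z i) w e).congr_deriv ?_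
  rw [← sum_neg_distrib]
  refine sum_congr rfl fun i _ => ?_
  simp [mul_comm]

theorem hasLineDerivAt_mul_prod {ι : Type*} [Fintype ι] [DecidableEq ι]
    {f : ℝ × ℝ → ℝ} {K : ι → ℝ × ℝ → ℝ}
    (hf : Differentiable ℝ f) (hK : ∀ i, Differentiable ℝ (K i)) (w e : ℝ × ℝ)
    (z : (ℝ × ℝ) × (ι → ℝ × ℝ)) :
    HasLineDerivAt ℝ (fun z : (ℝ × ℝ) × (ι → ℝ × ℝ) => f (z.1 - w) * ∏ k, K k (w - z.2 k))
      (fderiv ℝ f (z.1 - w) e * ∏ k, K k (w - z.2 k)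
        - f (z.1 - w) * ∑ i, fderiv ℝ (K i) (w - z.2 i) e
            * ∏ k ∈ univ.erase i, K k (w - z.2 k)) z (e, fun _ => e) := by
  refine ((hasDerivAt_comp_add_smul_sub hf z.1 w e).fun_mul
    (hasDerivAt_prod_comp_sub_add_smul hK univ z.2 w e)).congr_deriv ?_
  simp [sub_eq_add_neg]

theorem hasLineDerivAt_mul_sum_prod_erase {ι : Type*} [Fintype ι] [DecidableEq ι]
    {f : ℝ × ℝ → ℝ} {K g : ι → ℝ × ℝ → ℝ}
    (hf : Differentiable ℝ f) (hK : ∀ i, Differentiable ℝ (K i))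
    (hg : ∀ i, Differentiable ℝ (g i)) (w e : ℝ × ℝ) (z : (ℝ × ℝ) × (ι → ℝ × ℝ)) :
    HasLineDerivAt ℝ (fun z : (ℝ × ℝ) × (ι → ℝ × ℝ) =>
        f (z.1 - w) * ∑ i, g i (w - z.2 i) * ∏ k ∈ univ.erase i, K k (w - z.2 k))
      (fderiv ℝ f (z.1 - w) e * ∑ i, g i (w - z.2 i) * ∏ k ∈ univ.erase i, K k (w - z.2 k)
        - f (z.1 - w) * ∑ i, fderiv ℝ (g i) (w - z.2 i) e
            * ∏ k ∈ univ.erase i, K k (w - z.2 k)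
        - f (z.1 - w) * ∑ i, ∑ j ∈ univ.erase i, g i (w - z.2 i) * fderiv ℝ (K j) (w - z.2 j) e
            * ∏ k ∈ (univ.erase i).erase j, K k (w - z.2 k)) z (e, fun _ => e) := by
  refine ((hasDerivAt_comp_add_smul_sub hf z.1 w e).fun_mul
    (HasDerivAt.fun_sum fun i (_ : i ∈ univ) =>
      (hasDerivAt_comp_sub_add_smul (hg i) (z.2 i) w e).fun_mul
        (hasDerivAt_prod_comp_sub_add_smul hK (univ.erase i) z.2 w e))).congr_deriv ?_
  simp only [zero_smul, add_zero, neg_mul, mul_neg, sum_add_distrib, sum_neg_distrib, mul_assoc,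
    ← mul_sum]
  ring

theorem stmt6 (n : ℕ) (hn : 1 ≤ n) (c : ℝ)
    (K₀ : ℝ × ℝ → ℝ) (K : Fin n → ℝ × ℝ → ℝ)
    (hK₀ : ContDiff ℝ 2 K₀) (hK₀supp : HasCompactSupport K₀)
    (hK : ∀ i, ContDiff ℝ 2 (K i)) (hKsupp : ∀ i, HasCompactSupport (K i))
    (Q : (ℝ × ℝ) × (Fin n → ℝ × ℝ) → ℝ) (M : ℝ)
    (hQbd : ∀ z, |Q z| ≤ M) (hQcont : Continuous Q)
    (hQinv : ∀ (h z₀ : ℝ × ℝ) (zz : Fin n → ℝ × ℝ),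
      Q (z₀ + h, fun i => zz i + h) = Q (z₀, zz)) :
    ∀ w : ℝ × ℝ,
      (∫ z : (ℝ × ℝ) × (Fin n → ℝ × ℝ),
          Q z * (K₀ (z.1 - w)
            * ∑ i, Lop c (K i) (w - z.2 i) * ∏ k ∈ univ.erase i, K k (w - z.2 k)))
      = (∫ z : (ℝ × ℝ) × (Fin n → ℝ × ℝ),
            Q z * (Lop c K₀ (z.1 - w) * ∏ k, K k (w - z.2 k)))
        + c * ∫ z : (ℝ × ℝ) × (Fin n → ℝ × ℝ),
            Q z * (K₀ (z.1 - w) * ∑ i, ∑ j ∈ univ.erase i,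
              px (K i) (w - z.2 i) * px (K j) (w - z.2 j)
                * ∏ k ∈ (univ.erase i).erase j, K k (w - z.2 k)) := by
  intro w
  have : (volume : Measure (ℝ × ℝ)).IsAddHaarMeasure :=
    Measure.prod.instIsAddHaarMeasure volume volume
  have : (volume : Measure ((ℝ × ℝ) × (Fin n → ℝ × ℝ))).IsAddHaarMeasure :=
    Measure.prod.instIsAddHaarMeasure volume volume
  have hd {f : ℝ × ℝ → ℝ} {m : WithTop ℕ∞} (hf : ContDiff ℝ (m + 1) f) (e : ℝ × ℝ) :
      ContDiff ℝ m fun w => fderiv ℝ f w e :=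
    (hf.fderiv_right le_rfl).clm_apply contDiff_const
  have hint {f : ℝ × ℝ → ℝ} {m : WithTop ℕ∞} (hf : ContDiff ℝ m f) (hs : HasCompactSupport f) :
      Integrable f := hf.continuous.integrable_of_hasCompactSupport hs
  have hpt {f : ℝ × ℝ → ℝ} (hf : ContDiff ℝ 2 f) : ContDiff ℝ 1 (pt f) :=
    hd (hf.of_le (by norm_num)) _
  have hpx {f : ℝ × ℝ → ℝ} (hf : ContDiff ℝ 2 f) : ContDiff ℝ 1 (px f) :=
    hd (hf.of_le (by norm_num)) _
  have hpxx {f : ℝ × ℝ → ℝ} (hf : ContDiff ℝ 2 f) : ContDiff ℝ 0 (px (px f)) :=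
    hd ((hpx hf).of_le (by norm_num)) _
  have ipt {f : ℝ × ℝ → ℝ} (hf : ContDiff ℝ 2 f) (hs : HasCompactSupport f) :
      Integrable (pt f) := hint (hpt hf) (hs.fderiv_apply ℝ _)
  have ipx {f : ℝ × ℝ → ℝ} (hf : ContDiff ℝ 2 f) (hs : HasCompactSupport f) :
      Integrable (px f) := hint (hpx hf) (hs.fderiv_apply ℝ _)
  have ipxx {f : ℝ × ℝ → ℝ} (hf : ContDiff ℝ 2 f) (hs : HasCompactSupport f) :
      Integrable (px (px f)) := hint (hpxx hf) ((hs.fderiv_apply ℝ _).fderiv_apply ℝ _)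
  have hQ {F : (ℝ × ℝ) × (Fin n → ℝ × ℝ) → ℝ} (hF : Integrable F) :
      Integrable fun z => Q z * F z :=
    hF.bdd_mul hQcont.aestronglyMeasurable (.of_forall hQbd)
  have hinv (e : ℝ × ℝ) (z : (ℝ × ℝ) × (Fin n → ℝ × ℝ)) (t : ℝ) :
      Q (z + t • (e, fun _ => e)) = Q z := hQinv (t • e) z.1 z.2
  have i₀ := hint hK₀ hK₀supp
  have iK i := hint (hK i) (hKsupp i)
  have iKt i := ipt (hK i) (hKsupp i)
  have iKx i := ipx (hK i) (hKsupp i)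
  have iKxx i := ipxx (hK i) (hKsupp i)
  have d₀ := hK₀.differentiable two_ne_zero
  have dK i := (hK i).differentiable two_ne_zero
  have dx₀ := (hpx hK₀).differentiable one_ne_zero
  have dKx i := (hpx (hK i)).differentiable one_ne_zero
  have iLop {f : ℝ × ℝ → ℝ} (hf : ContDiff ℝ 2 f) (hs : HasCompactSupport f) :
      Integrable (Lop c f) := (ipt hf hs).sub ((ipxx hf hs).const_mul c)
  have I₀ := hQ (integrable_mul_sum_prod_erase i₀ iK (fun i => iLop (hK i) (hKsupp i)) w)
  have I₁ := hQ (integrable_mul_prod (iLop hK₀ hK₀supp) iK w)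
  have I₂ := hQ (integrable_mul_sum_sum_prod_erase i₀ iK iKx w)
  have It := hQ ((integrable_mul_prod (ipt hK₀ hK₀supp) iK w).sub
    (integrable_mul_sum_prod_erase i₀ iK iKt w))
  have J₁ := (integrable_mul_prod (ipxx hK₀ hK₀supp) iK w).sub
    (integrable_mul_sum_prod_erase (ipx hK₀ hK₀supp) iK iKx w)
  have J₂ := ((integrable_mul_sum_prod_erase (ipx hK₀ hK₀supp) iK iKx w).sub
    (integrable_mul_sum_prod_erase i₀ iK iKxx w)).sub
    (integrable_mul_sum_sum_prod_erase i₀ iK iKx w)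
  have Z := integral_mul_hasLineDerivAt_eq_zero (hinv (1, 0))
    (hQ (integrable_mul_prod i₀ iK w)) It (hasLineDerivAt_mul_prod d₀ dK w (1, 0))
  have Z₁ := integral_mul_hasLineDerivAt_eq_zero (hinv (0, 1))
    (hQ (integrable_mul_prod (ipx hK₀ hK₀supp) iK w)) (hQ J₁)
    (hasLineDerivAt_mul_prod dx₀ dK w (0, 1))
  have Z₂ := integral_mul_hasLineDerivAt_eq_zero (hinv (0, 1))
    (hQ (integrable_mul_sum_prod_erase i₀ iK iKx w)) (hQ J₂)
    (hasLineDerivAt_mul_sum_prod_erase d₀ dK dKx w (0, 1))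
  refine integral_eq_add_const_mul_integral c I₁ I₂ It (hQ J₁) (hQ J₂) Z Z₁ Z₂ fun z => ?_
  simp only [Pi.sub_apply, Lop, sub_mul, mul_assoc, sum_sub_distrib, ← mul_sum]
  ring
end

section
/- Let n ≥ 1 and c ∈ ℝ. Let (Ω, ℱ, P) be a probability space and ξ : Ω × ℝ² → ℝ a jointly measurable random field such that ξ(ω, ·) is continuous for every ω and |ξ(ω, z)| ≤ M for some constant M and all (ω, z). Assume ξ is (n+1)-point stationary: for all h, z₀,…,zₙ ∈ ℝ², E[∏_{i=0}^n ξ(z_i + h)] = E[∏_{i=0}^n ξ(z_i)]. Let K₀, K₁,…,Kₙ : ℝ² → ℝ be twice continuously differentiable with compact support; for a kernel K write (K ∗ ξ)(w) = ∫_{ℝ²} K(w − z) ξ(z) dz and Ǩ(z) = K(−z). Then for every w ∈ ℝ²: E[ ((∂_x K₀)ˇ ∗ ξ)(w) · ( Σ_{i=1}^n ((L_c K_i) ∗ ξ)(w) ∏_{k≠i} (K_k ∗ ξ)(w) − c Σ_{i≠j} ((∂_x K_i) ∗ ξ)(w) ((∂_x K_j) ∗ ξ)(w) ∏_{k∉{i,j}}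 (K_k ∗ ξ)(w) ) ] = E[ ((L_c K₀)ˇ ∗ ξ)(w) · Σ_{i=1}^n ((∂_x K_i) ∗ ξ)(w) ∏_{k≠i} (K_k ∗ ξ)(w) ], where (∂_x K₀)ˇ(z) = (∂_x K₀)(−z), (L_c K₀)ˇ(z) = (L_c K₀)(−z), and the sum over i ≠ j runs over all ordered pairs. -/
open MeasureTheory Finset

/-- Convolution `(K ∗ f)(w) = ∫ K(w − z) f(z) dz` on `ℝ × ℝ`. -/
noncomputable def conv (K f : ℝ × ℝ → ℝ) (w : ℝ × ℝ) : ℝ :=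
  ∫ z : ℝ × ℝ, K (w - z) * f z

/-- Reversed kernel `Ǩ(z) = K(−z)`. -/
def rev (K : ℝ × ℝ → ℝ) : ℝ × ℝ → ℝ := fun z => K (-z)

namespace ParabolicIBP

/-- Derivative of `f` in the direction `e`. -/
noncomputable def dirDeriv (e : ℝ × ℝ) (f : ℝ × ℝ → ℝ) (w : ℝ × ℝ) : ℝ := fderiv ℝ f w e

lemma contDiff_dirDeriv {f : ℝ × ℝ → ℝ} {m n : WithTop ℕ∞} (hf : ContDiff ℝ n f)
    (hmn : m + 1 ≤ n) (e : ℝ × ℝ) : ContDiff ℝ m (dirDeriv e f) :=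
  (hf.fderiv_right hmn).clm_apply contDiff_const

lemma hasCompactSupport_dirDeriv {f : ℝ × ℝ → ℝ} (hf : HasCompactSupport f) (e : ℝ × ℝ) :
    HasCompactSupport (dirDeriv e f) :=
  hf.fderiv_apply ℝ e

lemma dirDeriv_comm {f : ℝ × ℝ → ℝ} (hf : ContDiff ℝ 2 f) (e e' : ℝ × ℝ) :
    dirDeriv e (dirDeriv e' f) = dirDeriv e' (dirDeriv e f) := by
  have hd : Differentiable ℝ (fderiv ℝ f) :=
    (hf.fderiv_right (m := 1) (by norm_num)).differentiable (by simp)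
  have key : ∀ a b w, dirDeriv a (dirDeriv b f) w = fderiv ℝ (fderiv ℝ f) w a b := by
    intro a b w
    change fderiv ℝ (fun y => fderiv ℝ f y b) w a = _
    rw [fderiv_clm_apply (hd w) (differentiableAt_const b)]
    simp
  ext w
  rw [key, key]
  exact (hf.contDiffAt.isSymmSndFDerivAt (by simp)).eq e e'

lemma dirDeriv_rev (e : ℝ × ℝ) (f : ℝ × ℝ → ℝ) :
    dirDeriv e (rev f) = fun w => -rev (dirDeriv e f) w := by
  ext w
  change fderiv ℝ (fun z => f (-z)) w e = -(fderiv ℝ f (-w) e)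
  have h := fderiv_comp_smul (f := f) (x := w) (-1 : ℝ)
  simp only [neg_smul, one_smul] at h
  rw [h]
  simp

lemma dirDeriv_dirDeriv_rev (e e' : ℝ × ℝ) (f : ℝ × ℝ → ℝ) :
    dirDeriv e (dirDeriv e' (rev f)) = rev (dirDeriv e (dirDeriv e' f)) := by
  rw [dirDeriv_rev]
  ext w
  change fderiv ℝ (fun z => -rev (dirDeriv e' f) z) w e = _
  rw [fderiv_fun_neg]
  change -(dirDeriv e (rev (dirDeriv e' f)) w) = _
  rw [dirDeriv_rev, neg_neg]

lemma integrable_conv_kernel {G f : ℝ × ℝ → ℝ} (hG : Continuous G) (hGs : HasCompactSupport G)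
    (hf : Continuous f) (w : ℝ × ℝ) : Integrable fun z => G (w - z) * f z := by
  refine Continuous.integrable_of_hasCompactSupport (by fun_prop) ?_
  exact (hGs.comp_homeomorph (Homeomorph.subLeft w)).mul_right

lemma conv_neg (G f : ℝ × ℝ → ℝ) (w : ℝ × ℝ) :
    conv (fun z => -G z) f w = -conv G f w := by
  simp [conv, integral_neg]

lemma conv_sub_const_mul {G H f : ℝ × ℝ → ℝ} (hG : Continuous G) (hGs : HasCompactSupport G)
    (hH : Continuous H) (hHs : HasCompactSupport H) (hf : Continuous f) (c : ℝ) (w : ℝ × ℝ) :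
    conv (fun z => G z - c * H z) f w = conv G f w - c * conv H f w := by
  unfold conv
  rw [← integral_const_mul, ← integral_sub (integrable_conv_kernel hG hGs hf w)
    ((integrable_conv_kernel hH hHs hf w).const_mul c)]
  congr 1; ext z; ring

open scoped Convolution in
lemma hasDerivAt_conv {G f : ℝ × ℝ → ℝ} (hG : ContDiff ℝ 1 G) (hGs : HasCompactSupport G)
    (hf : Continuous f) (e w : ℝ × ℝ) (s : ℝ) :
    HasDerivAt (fun s : ℝ => conv G f (w + s • e)) (conv (dirDeriv e G) f (w + s • e)) s := by
  have hconv : ∀ H : ℝ × ℝ → ℝ, conv H f = H ⋆[ContinuousLinearMap.mul ℝ ℝ, volume] f := by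
    intro H; ext x
    rw [convolution_eq_swap]; rfl
  have h1 := hGs.hasFDerivAt_convolution_left (μ := volume) (ContinuousLinearMap.mul ℝ ℝ) hG
    hf.locallyIntegrable (w + s • e)
  have h2 : HasDerivAt (fun s : ℝ => w + s • e) e s := by
    simpa using ((hasDerivAt_id s).smul_const e).const_add w
  have h3 := h1.comp_hasDerivAt s h2
  rw [hconv G]
  refine h3.congr_deriv ?_
  have hex := (hGs.fderiv ℝ).convolutionExists_left
    ((ContinuousLinearMap.mul ℝ ℝ).precompL (ℝ × ℝ)) (μ := volume)
    (hG.continuous_fderiv (by simp)) hf.locallyIntegrable (w + s • e)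
  rw [hconv]
  unfold MeasureTheory.convolution
  rw [ContinuousLinearMap.integral_apply hex.integrable]
  rfl

section Random

variable {Ω : Type*} [MeasurableSpace Ω]

/-- A random field that is measurable at each point and bounded by a deterministic constant. -/
structure BoundedField (Y : Ω → ℝ × ℝ → ℝ) : Prop where
  measurable : ∀ w, Measurable fun ω => Y ω w
  bounded : ∃ C, ∀ ω w, |Y ω w| ≤ C

namespace BoundedField

variable {X Y : Ω → ℝ × ℝ → ℝ} {ι : Type*}

lemma add (hX : BoundedField X) (hY : BoundedField Y) :
    BoundedField fun ω w => X ω w + Y ω w := by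
  obtain ⟨C, hC⟩ := hX.bounded
  obtain ⟨D, hD⟩ := hY.bounded
  exact ⟨fun w => (hX.measurable w).add (hY.measurable w), C + D,
    fun ω w => (abs_add_le _ _).trans (add_le_add (hC ω w) (hD ω w))⟩

lemma mul (hX : BoundedField X) (hY : BoundedField Y) :
    BoundedField fun ω w => X ω w * Y ω w := by
  obtain ⟨C, hC⟩ := hX.bounded
  obtain ⟨D, hD⟩ := hY.bounded
  refine ⟨fun w => (hX.measurable w).mul (hY.measurable w), C * D, fun ω w => ?_⟩
  rw [abs_mul]
  exact mul_le_mul (hC ω w) (hD ω w) (abs_nonneg _) ((abs_nonneg _).trans (hC ω w))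

lemma const (c : ℝ) : BoundedField fun (_ : Ω) _ => c :=
  ⟨fun _ => measurable_const, |c|, fun _ _ => le_rfl⟩

lemma sum {Z : ι → Ω → ℝ × ℝ → ℝ} (hZ : ∀ i, BoundedField (Z i)) (s : Finset ι) :
    BoundedField fun ω w => ∑ i ∈ s, Z i ω w := by
  classical
  induction s using Finset.induction_on with
  | empty => simpa using const 0
  | insert i s hi ih => simpa only [Finset.sum_insert hi] using (hZ i).add ih

lemma prod {Z : ι → Ω → ℝ × ℝ → ℝ} (hZ : ∀ i, BoundedField (Z i)) (s : Finset ι) :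
    BoundedField fun ω w => ∏ i ∈ s, Z i ω w := by
  classical
  induction s using Finset.induction_on with
  | empty => simpa using const 1
  | insert i s hi ih => simpa only [Finset.prod_insert hi] using (hZ i).mul ih

lemma integrable (hX : BoundedField X) (P : Measure Ω) [IsFiniteMeasure P] (w : ℝ × ℝ) :
    Integrable (fun ω => X ω w) P := by
  obtain ⟨C, hC⟩ := hX.bounded
  exact Integrable.of_bound (hX.measurable w).aestronglyMeasurable C
    (Filter.Eventually.of_forall fun ω => hC ω w)

/-- If the mean of a bounded field is constant, then its directional derivative has mean zero. -/
lemma integral_deriv_eq_zero {P : Measure Ω} [IsFiniteMeasure P] (hX : BoundedField X)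
    (hY : BoundedField Y) (e : ℝ × ℝ)
    (hderiv : ∀ ω w (s : ℝ), HasDerivAt (fun s : ℝ => X ω (w + s • e)) (Y ω (w + s • e)) s)
    (hconst : ∀ w w', ∫ ω, X ω w ∂P = ∫ ω, X ω w' ∂P) (w : ℝ × ℝ) :
    ∫ ω, Y ω w ∂P = 0 := by
  obtain ⟨C, hC⟩ := hY.bounded
  have h := (hasDerivAt_integral_of_dominated_loc_of_deriv_le (μ := P) (x₀ := (0 : ℝ))
    (F := fun s ω => X ω (w + s • e)) (F' := fun s ω => Y ω (w + s • e)) (bound := fun _ => C)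
    Filter.univ_mem (Filter.Eventually.of_forall fun s => (hX.measurable _).aestronglyMeasurable)
    (hX.integrable P _) (hY.measurable _).aestronglyMeasurable
    (Filter.Eventually.of_forall fun ω s _ => hC ω _) (integrable_const C)
    (Filter.Eventually.of_forall fun ω s _ => hderiv ω w s)).2
  have h0 : (fun s : ℝ => ∫ ω, X ω (w + s • e) ∂P) = fun _ => ∫ ω, X ω w ∂P :=
    funext fun s => hconst _ _
  rw [h0] at h
  simpa using h.unique (hasDerivAt_const (0 : ℝ) _)

end BoundedField

/-- A bounded continuous random field whose `n + 1`-point correlations are translation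
invariant. -/
structure StationaryField (n : ℕ) (P : Measure Ω) (ξ : Ω → ℝ × ℝ → ℝ) : Prop where
  measurable : Measurable (Function.uncurry ξ)
  continuous : ∀ ω, Continuous (ξ ω)
  bounded : ∃ M, ∀ ω z, |ξ ω z| ≤ M
  stationary : ∀ (h : ℝ × ℝ) (z : Fin (n + 1) → ℝ × ℝ),
    (∫ ω, ∏ i, ξ ω (z i + h) ∂P) = ∫ ω, ∏ i, ξ ω (z i) ∂P

namespace StationaryField

variable {n : ℕ} {P : Measure Ω} {ξ : Ω → ℝ × ℝ → ℝ}

lemma boundedField_conv (hξ : StationaryField n P ξ) {G : ℝ × ℝ → ℝ} (hG : Continuous G)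
    (hGs : HasCompactSupport G) : BoundedField fun ω w => conv G (ξ ω) w := by
  obtain ⟨M, hM⟩ := hξ.bounded
  refine ⟨fun w => ?_, M * ∫ z, |G z|, fun ω w => ?_⟩
  · have hm : Measurable fun p : Ω × (ℝ × ℝ) => G (w - p.2) * ξ p.1 p.2 :=
      (hG.measurable.comp (measurable_const.sub measurable_snd)).mul hξ.measurable
    exact hm.stronglyMeasurable.integral_prod_right.measurable
  · have hI : Integrable fun z => |G (w - z)| :=
      ((hG.integrable_of_hasCompactSupport hGs).comp_sub_left w).abs
    calc |conv G (ξ ω) w| ≤ ∫ z, |G (w - z) * ξ ω z| := abs_integral_le_integral_abs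
      _ ≤ ∫ z, M * |G (w - z)| := by
          refine integral_mono (integrable_conv_kernel hG hGs (hξ.continuous ω) w).abs
            (hI.const_mul M) fun z => ?_
          dsimp only
          rw [abs_mul, mul_comm]
          exact mul_le_mul_of_nonneg_right (hM ω z) (abs_nonneg _)
      _ = M * ∫ z, |G z| := by
          rw [integral_const_mul, integral_sub_left_eq_self (fun z => |G z|) volume w]

lemma integral_prod_conv_add [IsFiniteMeasure P] (hξ : StationaryField n P ξ)
    {G : Fin (n + 1) → ℝ × ℝ → ℝ} (hG : ∀ i, Continuous (G i))
    (hGs : ∀ i, HasCompactSupport (G i)) (w h : ℝ × ℝ) :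
    ∫ ω, ∏ i, conv (G i) (ξ ω) (w + h) ∂P
      = ∫ z : Fin (n + 1) → ℝ × ℝ, (∏ i, G i (w - z i)) * ∫ ω, ∏ i, ξ ω (z i) ∂P := by
  obtain ⟨M, hM⟩ := hξ.bounded
  have hshift : ∀ ω i, conv (G i) (ξ ω) (w + h) = ∫ z, G i (w - z) * ξ ω (z + h) := by
    intro ω i
    unfold conv
    rw [← integral_add_right_eq_self _ h]
    simp
  have hint : Integrable (fun p : Ω × (Fin (n + 1) → ℝ × ℝ) =>
      (∏ i, G i (w - p.2 i)) * ∏ i, ξ p.1 (p.2 i + h)) (P.prod volume) := by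
    have h1 : Integrable (fun z : Fin (n + 1) → ℝ × ℝ => ∏ i, G i (w - z i)) volume :=
      Integrable.fintype_prod (f := fun i z => G i (w - z)) fun i =>
        ((hG i).integrable_of_hasCompactSupport (hGs i)).comp_sub_left w
    refine (h1.comp_snd P).mul_bdd (c := M ^ (n + 1)) ?_ ?_
    · refine Measurable.aestronglyMeasurable (Finset.measurable_prod _ fun i _ => ?_)
      exact hξ.measurable.comp (measurable_fst.prodMk
        ((continuous_add_const h).measurable.comp
          ((measurable_pi_apply i).comp measurable_snd)))
    · refine Filter.Eventually.of_forall fun p => ?_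
      rw [norm_prod]
      exact (Finset.prod_le_prod (fun i _ => norm_nonneg _) fun i _ => hM p.1 _).trans (by simp)
  simp_rw [hshift, ← integral_fintype_prod_volume_eq_prod, Finset.prod_mul_distrib]
  rw [integral_integral_swap hint]
  simp_rw [integral_const_mul, hξ.stationary]

lemma integral_prod_conv_eq [IsFiniteMeasure P] (hξ : StationaryField n P ξ)
    {G : Fin (n + 1) → ℝ × ℝ → ℝ} (hG : ∀ i, Continuous (G i))
    (hGs : ∀ i, HasCompactSupport (G i)) (w w' : ℝ × ℝ) :
    ∫ ω, ∏ i, conv (G i) (ξ ω) w ∂P = ∫ ω, ∏ i, conv (G i) (ξ ω) w' ∂P := by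
  have h := hξ.integral_prod_conv_add hG hGs w'
  rw [← add_zero w', h 0, ← h (w - w')]
  simp

/-- First-order integration by parts. -/
lemma integral_deriv_conv_mul_prod [IsFiniteMeasure P] (hξ : StationaryField n P ξ)
    {J : ℝ × ℝ → ℝ} {K : Fin n → ℝ × ℝ → ℝ} (hJ : ContDiff ℝ 1 J) (hJs : HasCompactSupport J)
    (hK : ∀ i, ContDiff ℝ 1 (K i)) (hKs : ∀ i, HasCompactSupport (K i)) (e w : ℝ × ℝ) :
    ∫ ω, (conv (dirDeriv e J) (ξ ω) w * ∏ i, conv (K i) (ξ ω) w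
      + conv J (ξ ω) w * ∑ i, conv (dirDeriv e (K i)) (ξ ω) w
          * ∏ k ∈ univ.erase i, conv (K k) (ξ ω) w) ∂P = 0 := by
  have bJ := hξ.boundedField_conv hJ.continuous hJs
  have bK := fun i => hξ.boundedField_conv (hK i).continuous (hKs i)
  have bdJ := hξ.boundedField_conv (contDiff_dirDeriv (m := 0) hJ (by simp) e).continuous
    (hasCompactSupport_dirDeriv hJs e)
  have bdK := fun i => hξ.boundedField_conv
    (contDiff_dirDeriv (m := 0) (hK i) (by simp) e).continuous
    (hasCompactSupport_dirDeriv (hKs i) e)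
  refine BoundedField.integral_deriv_eq_zero (bJ.mul (.prod bK univ))
    (Y := fun ω w => conv (dirDeriv e J) (ξ ω) w * ∏ i, conv (K i) (ξ ω) w
      + conv J (ξ ω) w * ∑ i, conv (dirDeriv e (K i)) (ξ ω) w
          * ∏ k ∈ univ.erase i, conv (K k) (ξ ω) w)
    ((bdJ.mul (.prod bK univ)).add
      (bJ.mul (.sum (fun i => (bdK i).mul (.prod bK (univ.erase i))) univ)))
    e (fun ω w s => ?_) (fun w w' => ?_) w
  · have hc := hξ.continuous ω
    refine ((hasDerivAt_conv hJ hJs hc e w s).mul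
      (HasDerivAt.fun_finsetProd (u := univ)
        fun i _ => hasDerivAt_conv (hK i) (hKs i) hc e w s)).congr_deriv ?_
    simp only [smul_eq_mul, mul_comm (∏ _ ∈ _, _)]
  · have h := hξ.integral_prod_conv_eq (G := Fin.cons J K)
      (Fin.cases hJ.continuous fun i => (hK i).continuous) (Fin.cases hJs hKs) w w'
    simpa only [Fin.prod_univ_succ, Fin.cons_zero, Fin.cons_succ] using h

/-- The first derivative, in direction `e`, of a product of convolutions. -/
noncomputable def prodDeriv (K : Fin n → ℝ × ℝ → ℝ) (f : ℝ × ℝ → ℝ) (e w : ℝ × ℝ) : ℝ :=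
  ∑ i, conv (dirDeriv e (K i)) f w * ∏ k ∈ univ.erase i, conv (K k) f w

/-- The second derivative, in directions `e` and `e'`, of a product of convolutions. -/
noncomputable def prodDeriv₂ (K : Fin n → ℝ × ℝ → ℝ) (f : ℝ × ℝ → ℝ) (e e' w : ℝ × ℝ) : ℝ :=
  ∑ i, conv (dirDeriv e (dirDeriv e' (K i))) f w * ∏ k ∈ univ.erase i, conv (K k) f w
    + ∑ i, ∑ j ∈ univ.erase i, conv (dirDeriv e' (K i)) f w * conv (dirDeriv e (K j)) f w
        * ∏ k ∈ (univ.erase i).erase j, conv (K k) f w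

lemma prodDeriv₂_comm {K : Fin n → ℝ × ℝ → ℝ} (hK : ∀ i, ContDiff ℝ 2 (K i)) (f : ℝ × ℝ → ℝ)
    (e e' w : ℝ × ℝ) : prodDeriv₂ K f e e' w = prodDeriv₂ K f e' e w := by
  unfold prodDeriv₂
  simp_rw [fun i => dirDeriv_comm (hK i) e e']
  congr 1
  rw [Finset.sum_comm' (t' := univ) (s' := fun j => univ.erase j)
    (by simp [eq_comm])]
  refine Finset.sum_congr rfl fun i _ => Finset.sum_congr rfl fun j _ => ?_
  rw [Finset.erase_right_comm]
  ring

lemma boundedField_prodDeriv (hξ : StationaryField n P ξ) {K : Fin n → ℝ × ℝ → ℝ}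
    (hK : ∀ i, ContDiff ℝ 1 (K i)) (hKs : ∀ i, HasCompactSupport (K i)) (e : ℝ × ℝ) :
    BoundedField fun ω w => prodDeriv K (ξ ω) e w :=
  .sum (fun i => (hξ.boundedField_conv
    (contDiff_dirDeriv (m := 0) (hK i) (by simp) e).continuous
    (hasCompactSupport_dirDeriv (hKs i) e)).mul
      (.prod (fun k => hξ.boundedField_conv (hK k).continuous (hKs k)) _)) _

lemma boundedField_prodDeriv₂ (hξ : StationaryField n P ξ) {K : Fin n → ℝ × ℝ → ℝ}
    (hK : ∀ i, ContDiff ℝ 2 (K i)) (hKs : ∀ i, HasCompactSupport (K i)) (e e' : ℝ × ℝ) :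
    BoundedField fun ω w => prodDeriv₂ K (ξ ω) e e' w := by
  have b := fun i => hξ.boundedField_conv (hK i).continuous (hKs i)
  have b₁ := fun e i => hξ.boundedField_conv
    (contDiff_dirDeriv (m := 1) (hK i) (by norm_num) e).continuous
    (hasCompactSupport_dirDeriv (hKs i) e)
  have b₂ := fun i => hξ.boundedField_conv (contDiff_dirDeriv (m := 0)
    (contDiff_dirDeriv (m := 1) (hK i) (by norm_num) e') (by simp) e).continuous
    (hasCompactSupport_dirDeriv (hasCompactSupport_dirDeriv (hKs i) e') e)
  exact .add (.sum (fun i => (b₂ i).mul (.prod b _)) _)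
    (.sum (fun i => .sum (fun j => ((b₁ e' i).mul (b₁ e j)).mul (.prod b _)) _) _)

lemma sum_conv_dirDeriv_update (K : Fin n → ℝ × ℝ → ℝ) (f : ℝ × ℝ → ℝ) (e w : ℝ × ℝ)
    (i : Fin n) (H : ℝ × ℝ → ℝ) :
    ∑ j, conv (dirDeriv e (Function.update K i H j)) f w
        * ∏ k ∈ univ.erase j, conv (Function.update K i H k) f w
      = conv (dirDeriv e H) f w * ∏ k ∈ univ.erase i, conv (K k) f w
        + ∑ j ∈ univ.erase i, conv H f w * conv (dirDeriv e (K j)) f w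
            * ∏ k ∈ (univ.erase i).erase j, conv (K k) f w := by
  rw [← Finset.add_sum_erase _ _ (Finset.mem_univ i)]
  congr 1
  · rw [Function.update_self]
    congr 1
    exact Finset.prod_congr rfl fun k hk => by
      rw [Function.update_of_ne (Finset.ne_of_mem_erase hk)]
  · refine Finset.sum_congr rfl fun j hj => ?_
    have hji := Finset.ne_of_mem_erase hj
    rw [Function.update_of_ne hji, ← Finset.mul_prod_erase (univ.erase j) _
      (Finset.mem_erase.2 ⟨hji.symm, Finset.mem_univ i⟩), Function.update_self,
      Finset.erase_right_comm]
    rw [Finset.prod_congr rfl fun k hk => by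
      rw [Function.update_of_ne (Finset.ne_of_mem_erase (Finset.mem_of_mem_erase hk))]]
    ring

lemma prod_conv_update (K : Fin n → ℝ × ℝ → ℝ) (f : ℝ × ℝ → ℝ) (w : ℝ × ℝ) (i : Fin n)
    (H : ℝ × ℝ → ℝ) :
    ∏ j, conv (Function.update K i H j) f w
      = conv H f w * ∏ k ∈ univ.erase i, conv (K k) f w := by
  rw [← Finset.mul_prod_erase _ _ (Finset.mem_univ i), Function.update_self]
  congr 1
  exact Finset.prod_congr rfl fun k hk => by
    rw [Function.update_of_ne (Finset.ne_of_mem_erase hk)]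

/-- Second-order integration by parts. -/
lemma integral_deriv_conv_mul_prodDeriv [IsFiniteMeasure P] (hξ : StationaryField n P ξ)
    {J : ℝ × ℝ → ℝ} {K : Fin n → ℝ × ℝ → ℝ} (hJ : ContDiff ℝ 1 J) (hJs : HasCompactSupport J)
    (hK : ∀ i, ContDiff ℝ 2 (K i)) (hKs : ∀ i, HasCompactSupport (K i)) (e e' w : ℝ × ℝ) :
    ∫ ω, conv (dirDeriv e J) (ξ ω) w * prodDeriv K (ξ ω) e' w ∂P
      = -∫ ω, conv J (ξ ω) w * prodDeriv₂ K (ξ ω) e e' w ∂P := by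
  have hK1 := fun i => (hK i).of_le (m := 1) (by norm_num)
  have bJ := hξ.boundedField_conv hJ.continuous hJs
  have bdJ := hξ.boundedField_conv (contDiff_dirDeriv (m := 0) hJ (by simp) e).continuous
    (hasCompactSupport_dirDeriv hJs e)
  have b := fun i => hξ.boundedField_conv (hK i).continuous (hKs i)
  have b₁ := fun e i => hξ.boundedField_conv
    (contDiff_dirDeriv (m := 1) (hK i) (by norm_num) e).continuous
    (hasCompactSupport_dirDeriv (hKs i) e)
  have b₂ := fun i => hξ.boundedField_conv (contDiff_dirDeriv (m := 0)
    (contDiff_dirDeriv (m := 1) (hK i) (by norm_num) e') (by simp) e).continuous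
    (hasCompactSupport_dirDeriv (hasCompactSupport_dirDeriv (hKs i) e') e)
  have key : ∀ i, ∫ ω, (conv (dirDeriv e J) (ξ ω) w
        * (conv (dirDeriv e' (K i)) (ξ ω) w * ∏ k ∈ univ.erase i, conv (K k) (ξ ω) w)
      + conv J (ξ ω) w * (conv (dirDeriv e (dirDeriv e' (K i))) (ξ ω) w
            * ∏ k ∈ univ.erase i, conv (K k) (ξ ω) w
        + ∑ j ∈ univ.erase i, conv (dirDeriv e' (K i)) (ξ ω) w * conv (dirDeriv e (K j)) (ξ ω) w
            * ∏ k ∈ (univ.erase i).erase j, conv (K k) (ξ ω) w)) ∂P = 0 := by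
    intro i
    have h := hξ.integral_deriv_conv_mul_prod hJ hJs
      (K := Function.update K i (dirDeriv e' (K i))) (fun j => ?_) (fun j => ?_) e w
    · simpa only [sum_conv_dirDeriv_update, prod_conv_update] using h
    · rcases eq_or_ne j i with rfl | hj
      · rw [Function.update_self]; exact contDiff_dirDeriv (hK j) (by norm_num) e'
      · rw [Function.update_of_ne hj]; exact hK1 j
    · rcases eq_or_ne j i with rfl | hj
      · rw [Function.update_self]; exact hasCompactSupport_dirDeriv (hKs j) e'
      · rw [Function.update_of_ne hj]; exact hKs j
  have hsum := Finset.sum_eq_zero fun i (_ : i ∈ (univ : Finset (Fin n))) => key i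
  rw [← integral_finsetSum _ fun i _ => BoundedField.integrable
    ((bdJ.mul ((b₁ e' i).mul (.prod b (univ.erase i)))).add (bJ.mul
      (((b₂ i).mul (.prod b (univ.erase i))).add
        (.sum (fun j => ((b₁ e' i).mul (b₁ e j)).mul (.prod b ((univ.erase i).erase j)))
          (univ.erase i))))) P w] at hsum
  rw [eq_neg_iff_add_eq_zero, ← integral_add
    ((bdJ.mul (hξ.boundedField_prodDeriv hK1 hKs e')).integrable P w)
    ((bJ.mul (hξ.boundedField_prodDeriv₂ hK hKs e e')).integrable P w), ← hsum]
  refine integral_congr_ae (Filter.Eventually.of_forall fun ω => ?_)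
  simp only [prodDeriv, prodDeriv₂, Finset.sum_add_distrib, ← Finset.mul_sum]

end StationaryField

end Random

end ParabolicIBP

open ParabolicIBP StationaryField in
theorem stmt10 (n : ℕ) (hn : 1 ≤ n) (c : ℝ)
    {Ω : Type*} [MeasurableSpace Ω] (P : Measure Ω) [IsProbabilityMeasure P]
    (ξ : Ω → ℝ × ℝ → ℝ) (hmeas : Measurable (Function.uncurry ξ))
    (hcont : ∀ ω, Continuous (ξ ω))
    (M : ℝ) (hbd : ∀ ω z, |ξ ω z| ≤ M)
    (hstat : ∀ (h : ℝ × ℝ) (z : Fin (n + 1) → ℝ × ℝ),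
      (∫ ω, ∏ i, ξ ω (z i + h) ∂P) = ∫ ω, ∏ i, ξ ω (z i) ∂P)
    (K₀ : ℝ × ℝ → ℝ) (K : Fin n → ℝ × ℝ → ℝ)
    (hK₀ : ContDiff ℝ 2 K₀) (hK₀supp : HasCompactSupport K₀)
    (hK : ∀ i, ContDiff ℝ 2 (K i)) (hKsupp : ∀ i, HasCompactSupport (K i)) :
    ∀ w : ℝ × ℝ,
      (∫ ω, conv (rev (px K₀)) (ξ ω) w
          * ((∑ i, conv (Lop c (K i)) (ξ ω) w
                * ∏ k ∈ univ.erase i, conv (K k) (ξ ω) w)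
            - c * ∑ i, ∑ j ∈ univ.erase i,
                conv (px (K i)) (ξ ω) w * conv (px (K j)) (ξ ω) w
                  * ∏ k ∈ (univ.erase i).erase j, conv (K k) (ξ ω) w) ∂P)
      = ∫ ω, conv (rev (Lop c K₀)) (ξ ω) w
          * ∑ i, conv (px (K i)) (ξ ω) w
              * ∏ k ∈ univ.erase i, conv (K k) (ξ ω) w ∂P := by
  intro w
  have hξ : StationaryField n P ξ := ⟨hmeas, hcont, ⟨M, hbd⟩, hstat⟩
  set et : ℝ × ℝ := (1, 0)
  set ex : ℝ × ℝ := (0, 1)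
  have hV : ContDiff ℝ 2 (rev K₀) := hK₀.comp contDiff_neg
  have hVs : HasCompactSupport (rev K₀) := hK₀supp.comp_homeomorph (Homeomorph.neg _)
  have hV1 : ContDiff ℝ 1 (rev K₀) := hV.of_le (by norm_num)
  have hVx : ContDiff ℝ 1 (dirDeriv ex (rev K₀)) := contDiff_dirDeriv hV (by norm_num) ex
  have hVt : ContDiff ℝ 1 (dirDeriv et (rev K₀)) := contDiff_dirDeriv hV (by norm_num) et
  have hVxs := hasCompactSupport_dirDeriv hVs ex
  have hVts := hasCompactSupport_dirDeriv hVs et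
  have hVxx : Continuous (dirDeriv ex (dirDeriv ex (rev K₀))) :=
    (contDiff_dirDeriv (m := 0) hVx (by simp) ex).continuous
  have hVxxs := hasCompactSupport_dirDeriv hVxs ex
  have hK1 := fun i => (hK i).of_le (m := 1) (by norm_num)
  have hxt : ∫ ω, conv (dirDeriv ex (rev K₀)) (ξ ω) w * prodDeriv K (ξ ω) et w ∂P
      = ∫ ω, conv (dirDeriv et (rev K₀)) (ξ ω) w * prodDeriv K (ξ ω) ex w ∂P := by
    rw [hξ.integral_deriv_conv_mul_prodDeriv hV1 hVs hK hKsupp,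
      hξ.integral_deriv_conv_mul_prodDeriv hV1 hVs hK hKsupp]
    simp_rw [prodDeriv₂_comm hK _ et ex]
  have hxx := hξ.integral_deriv_conv_mul_prodDeriv hVx hVxs hK hKsupp ex ex w
  have hleft : ∀ ω, conv (rev (px K₀)) (ξ ω) w
        * ((∑ i, conv (Lop c (K i)) (ξ ω) w * ∏ k ∈ univ.erase i, conv (K k) (ξ ω) w)
          - c * ∑ i, ∑ j ∈ univ.erase i, conv (px (K i)) (ξ ω) w * conv (px (K j)) (ξ ω) w
              * ∏ k ∈ (univ.erase i).erase j, conv (K k) (ξ ω) w)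
      = c * (conv (dirDeriv ex (rev K₀)) (ξ ω) w * prodDeriv₂ K (ξ ω) ex ex w)
        - conv (dirDeriv ex (rev K₀)) (ξ ω) w * prodDeriv K (ξ ω) et w := by
    intro ω
    have h1 : conv (dirDeriv ex (rev K₀)) (ξ ω) w = -conv (rev (px K₀)) (ξ ω) w := by
      rw [dirDeriv_rev, conv_neg]; rfl
    have h2 : ∀ i, conv (Lop c (K i)) (ξ ω) w = conv (dirDeriv et (K i)) (ξ ω) w
        - c * conv (dirDeriv ex (dirDeriv ex (K i))) (ξ ω) w := fun i =>
      have hx := contDiff_dirDeriv (m := 1) (hK i) (by norm_num) ex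
      conv_sub_const_mul (contDiff_dirDeriv (m := 0) (hK1 i) (by simp) et).continuous
        (hasCompactSupport_dirDeriv (hKsupp i) et)
        (contDiff_dirDeriv (m := 0) hx (by simp) ex).continuous
        (hasCompactSupport_dirDeriv (hasCompactSupport_dirDeriv (hKsupp i) ex) ex)
        (hcont ω) c w
    have h3 : ∀ i, px (K i) = dirDeriv ex (K i) := fun i => rfl
    simp_rw [h1, h2, h3, prodDeriv, prodDeriv₂, sub_mul, Finset.sum_sub_distrib, mul_assoc c,
      ← Finset.mul_sum]
    ring
  have hright : ∀ ω, conv (rev (Lop c K₀)) (ξ ω) w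
        * ∑ i, conv (px (K i)) (ξ ω) w * ∏ k ∈ univ.erase i, conv (K k) (ξ ω) w
      = -(conv (dirDeriv et (rev K₀)) (ξ ω) w * prodDeriv K (ξ ω) ex w)
        - c * (conv (dirDeriv ex (dirDeriv ex (rev K₀))) (ξ ω) w * prodDeriv K (ξ ω) ex w) := by
    intro ω
    have h1 : rev (Lop c K₀) = fun z => -dirDeriv et (rev K₀) z
        - c * dirDeriv ex (dirDeriv ex (rev K₀)) z := by
      rw [dirDeriv_dirDeriv_rev, dirDeriv_rev]
      simp only [neg_neg]
      rfl
    rw [h1, conv_sub_const_mul (G := fun z => -dirDeriv et (rev K₀) z)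
      hVt.continuous.neg hVts.neg hVxx hVxxs (hcont ω) c w, conv_neg]
    change _ * prodDeriv K (ξ ω) ex w = _
    ring
  have bF := fun e => hξ.boundedField_prodDeriv hK1 hKsupp e
  have bVx := hξ.boundedField_conv hVx.continuous hVxs
  have bVt := hξ.boundedField_conv hVt.continuous hVts
  have bVxx := hξ.boundedField_conv hVxx hVxxs
  simp_rw [hleft, hright]
  have bF₂ := hξ.boundedField_prodDeriv₂ hK hKsupp ex ex
  rw [integral_sub (((bVx.mul bF₂).integrable P w).const_mul c)
      ((bVx.mul (bF et)).integrable P w),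
    integral_sub (f := fun ω => -(conv (dirDeriv et (rev K₀)) (ξ ω) w * prodDeriv K (ξ ω) ex w))
      ((bVt.mul (bF ex)).integrable P w).neg
      (((bVxx.mul (bF ex)).integrable P w).const_mul c),
    integral_neg, integral_const_mul, integral_const_mul, hxx, hxt]
  ring
end

section
/- Let d ≥ 1 and let T be a tempered distribution on ℝ^d (a continuous linear functional on the Schwartz space 𝒮(ℝ^d, ℝ)) that is translation-invariant, i.e. T(φ(· − h)) = T(φ) for every h ∈ ℝ^d and every Schwartz function φ. Then T is a constant multiple of Lebesgue measure: there exists a real constant a such that T(φ) = a ∫_{ℝ^d} φ(z) dz for all φ ∈ 𝒮(ℝ^d, ℝ). -/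
open MeasureTheory SchwartzMap

open Filter Topology Convolution Pointwise
open scoped ContDiff

section InvariantDistributions

variable {E : Type*} [NormedAddCommGroup E] [NormedSpace ℝ E]

theorem iteratedFDeriv_convolution_lsmul_right [MeasurableSpace E] [BorelSpace E]
    {μ : Measure E} [SFinite μ] [μ.IsAddLeftInvariant] {f g : E → ℝ} (hf : LocallyIntegrable f μ)
    (hgc : HasCompactSupport g) (hg : ContDiff ℝ ∞ g) (n : ℕ) :
    iteratedFDeriv ℝ n (f ⋆[ContinuousLinearMap.lsmul ℝ ℝ, μ] g) =
      f ⋆[ContinuousLinearMap.lsmul ℝ ℝ, μ] (iteratedFDeriv ℝ n g) := by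
  induction n with
  | zero =>
    ext1 x
    simp only [iteratedFDeriv_zero_eq_comp, Function.comp_apply, MeasureTheory.convolution,
      ContinuousLinearMap.lsmul_apply, ← map_smul]
    exact ((continuousMultilinearCurryFin0 ℝ E ℝ).symm.toContinuousLinearEquiv.integral_comp_comm
      _).symm
  | succ n ih =>
    ext1 x
    have hd : ContDiff ℝ 1 (iteratedFDeriv ℝ n g) := hg.iteratedFDeriv_right (by exact_mod_cast le_top)
    rw [iteratedFDeriv_succ_eq_comp_left, Function.comp_apply, ih,
      (HasCompactSupport.hasFDerivAt_convolution_right _ (hgc.iteratedFDeriv n) hf hd x).fderiv,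
      iteratedFDeriv_succ_eq_comp_left]
    simp only [MeasureTheory.convolution, Function.comp_apply, ContinuousLinearMap.lsmul_apply, ← map_smul]
    exact (ContinuousLinearEquiv.integral_comp_comm (𝕜 := ℝ) (E := E →L[ℝ] E [×n]→L[ℝ] ℝ)
      (F := E [×(n + 1)]→L[ℝ] ℝ) (μ := μ)
      (continuousMultilinearCurryLeftEquiv ℝ (fun _ : Fin (n + 1) => E)
        ℝ).symm.toContinuousLinearEquiv
      (fun t => f t • fderiv ℝ (iteratedFDeriv ℝ n g) (x - t))).symm

theorem SchwartzMap.continuous_iteratedFDeriv (f : 𝓢(E, ℝ)) (n : ℕ) :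
    Continuous (iteratedFDeriv ℝ n f) :=
  (f.smooth n).continuous_iteratedFDeriv'

/-- Families `(uₙ)`, `n ≤ N`, of continuous functions on `K` with values in `n`-linear forms, normed
by the maximum of the sup norms. -/
def JetSpace (K : Set E) (N : ℕ) : Type _ :=
  (n : Fin (N + 1)) → C(K, E [×n]→L[ℝ] ℝ)

namespace JetSpace

variable {K : Set E} {N : ℕ}

@[ext]
theorem ext {u v : JetSpace K N} (h : ∀ n x, u n x = v n x) : u = v :=
  funext fun n => ContinuousMap.ext (h n)

variable [CompactSpace K]

noncomputable instance : NormedAddCommGroup (JetSpace K N) :=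
  inferInstanceAs (NormedAddCommGroup ((n : Fin (N + 1)) → C(K, E [×n]→L[ℝ] ℝ)))

noncomputable instance : NormedSpace ℝ (JetSpace K N) :=
  inferInstanceAs (NormedSpace ℝ ((n : Fin (N + 1)) → C(K, E [×n]→L[ℝ] ℝ)))

instance : CompleteSpace (JetSpace K N) :=
  inferInstanceAs (CompleteSpace ((n : Fin (N + 1)) → C(K, E [×n]→L[ℝ] ℝ)))

theorem norm_apply_apply_le (u : JetSpace K N) (n : Fin (N + 1)) (x : K) : ‖u n x‖ ≤ ‖u‖ :=
  ((u n).norm_coe_le_norm x).trans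
    (norm_le_pi_norm (show (n : Fin (N + 1)) → C(K, E [×n]→L[ℝ] ℝ) from u) n)

/-- Evaluation of the component of order `n` at `x`. -/
noncomputable def evalCLM (n : Fin (N + 1)) (x : K) : JetSpace K N →L[ℝ] (E [×n]→L[ℝ] ℝ) :=
  LinearMap.mkContinuous
    { toFun := fun u => u n x
      map_add' := fun _ _ => rfl
      map_smul' := fun _ _ => rfl } 1
    fun u => (u.norm_apply_apply_le n x).trans_eq (one_mul _).symm

end JetSpace

/-- The jet of order `N` of a Schwartz function, restricted to `K`. -/
noncomputable def SchwartzMap.jetOn (K : Set E) [CompactSpace K] (N : ℕ) :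
    𝓢(E, ℝ) →ₗ[ℝ] JetSpace K N where
  toFun f n := ⟨fun x => iteratedFDeriv ℝ n f x,
    (f.continuous_iteratedFDeriv n).comp continuous_subtype_val⟩
  map_add' f g := JetSpace.ext fun n _ =>
    iteratedFDeriv_add_apply (f.smooth n).contDiffAt (g.smooth n).contDiffAt
  map_smul' _ f := JetSpace.ext fun n _ =>
    iteratedFDeriv_const_smul_apply (f.smooth n).contDiffAt

/-- Schwartz functions vanishing outside `K`. -/
def SchwartzMap.supportedIn (K : Set E) : Submodule ℝ 𝓢(E, ℝ) where
  carrier := {f | ∀ x ∉ K, f x = 0}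
  add_mem' hf hg x hx := by simp [hf x hx, hg x hx]
  zero_mem' x _ := rfl
  smul_mem' c f hf x hx := by simp [hf x hx]

theorem SchwartzMap.exists_eq_comp_jetOn (T : 𝓢(E, ℝ) →L[ℝ] ℝ) (K : Set E) [CompactSpace K] :
    ∃ (N : ℕ) (L : JetSpace K N →L[ℝ] ℝ),
      ∀ f ∈ supportedIn K, T f = L (jetOn K N f) := by
  have hK : IsCompact K := isCompact_iff_compactSpace.mpr inferInstance
  obtain ⟨R, hR⟩ := hK.isBounded.exists_norm_le
  obtain ⟨s, C, -, hC⟩ := Seminorm.bound_of_continuous (schwartz_withSeminorms ℝ E ℝ)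
    ((normSeminorm ℝ ℝ).comp T.toLinearMap) (by exact (continuous_norm.comp T.continuous))
  set N := s.sup Prod.snd
  set J := (jetOn K N).domRestrict (supportedIn K) with hJ
  have hJinj : Function.Injective J := by
    refine (injective_iff_map_eq_zero J).mpr fun f hf => ?_
    ext x
    by_cases hx : x ∈ K
    · have h := congrArg (fun u => u ⟨x, hx⟩ 0) (congrFun hf 0)
      exact (iteratedFDeriv_zero_apply (0 : Fin 0 → E)).symm.trans h
    · exact f.2 x hx
  set M : ℝ := C * ∑ i ∈ s, |R| ^ i.1
  have hbound (f : supportedIn K) : ‖T f‖ ≤ M * ‖J f‖ := by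
    have hsup : (s.sup (schwartzSeminormFamily ℝ E ℝ)) (f : 𝓢(E, ℝ)) ≤
        (∑ i ∈ s, |R| ^ i.1) * ‖J f‖ := by
      refine Seminorm.finset_sup_apply_le (by positivity) fun i hi => ?_
      refine SchwartzMap.seminorm_le_bound ℝ i.1 i.2 _ (by positivity) fun x => ?_
      by_cases hx : x ∈ K
      · have hn : i.2 < N + 1 := Nat.lt_succ_of_le (Finset.le_sup (f := Prod.snd) hi)
        have h1 : ‖iteratedFDeriv ℝ i.2 (f : 𝓢(E, ℝ)) x‖ ≤ ‖J f‖ :=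
          (J f).norm_apply_apply_le ⟨i.2, hn⟩ ⟨x, hx⟩
        have h2 : ‖x‖ ^ i.1 ≤ ∑ i ∈ s, |R| ^ i.1 :=
          (pow_le_pow_left₀ (norm_nonneg _) ((hR x hx).trans (le_abs_self R)) _).trans
            (Finset.single_le_sum (f := fun i : ℕ × ℕ => |R| ^ i.1)
              (fun _ _ => by positivity) hi)
        gcongr
      · have hts : tsupport (f : 𝓢(E, ℝ)) ⊆ K :=
          closure_minimal (fun y hy => by_contra fun hyK => hy (f.2 y hyK)) hK.isClosed
        have h0 : iteratedFDeriv ℝ i.2 (f : 𝓢(E, ℝ)) x = 0 :=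
          Function.notMem_support.mp fun h => hx (hts (support_iteratedFDeriv_subset _ h))
        rw [h0, norm_zero, mul_zero]
        positivity
    calc ‖T f‖ ≤ C * (s.sup (schwartzSeminormFamily ℝ E ℝ)) (f : 𝓢(E, ℝ)) := hC f
      _ ≤ C * ((∑ i ∈ s, |R| ^ i.1) * ‖J f‖) := by gcongr
      _ = M * ‖J f‖ := (mul_assoc _ _ _).symm
  set e := LinearEquiv.ofInjective J hJinj
  obtain ⟨L, hL, -⟩ := exists_extension_norm_eq (LinearMap.range J)
    (((T.toLinearMap.domRestrict (supportedIn K)).comp e.symm.toLinearMap).mkContinuous M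
      fun u => by
        obtain ⟨f, rfl⟩ := e.surjective u
        rw [LinearMap.comp_apply, LinearEquiv.coe_coe, e.symm_apply_apply]
        exact hbound f)
  refine ⟨N, L, fun f hf => ?_⟩
  have h := hL (e ⟨f, hf⟩)
  simp only [LinearMap.mkContinuous_apply, LinearMap.comp_apply, LinearEquiv.coe_coe,
    LinearEquiv.symm_apply_apply] at h
  exact h.symm

theorem SchwartzMap.continuous_jetOn_translate (K : Set E) [CompactSpace K] (N : ℕ) (f : 𝓢(E, ℝ)) :
    Continuous fun y : E => jetOn K N (f.compSubConstCLM ℝ y) := by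
  refine continuous_pi fun n => ?_
  have h : Continuous fun p : E × K => iteratedFDeriv ℝ n f (p.2 - p.1) :=
    (f.continuous_iteratedFDeriv n).comp (by fun_prop)
  refine (ContinuousMap.curry ⟨_, h⟩).continuous.congr fun y => ?_
  exact ContinuousMap.ext fun x =>
    (iteratedFDeriv_comp_sub (𝕜 := ℝ) (f := f) n y (x : E)).symm

theorem SchwartzMap.dense_hasCompactSupport [FiniteDimensional ℝ E] :
    Dense {f : 𝓢(E, ℝ) | HasCompactSupport f} := by
  intro f
  let χ : ContDiffBump (0 : E) := ⟨1, 2, one_pos, one_lt_two⟩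
  let ε : ℕ → ℝ := fun m => 1 / ((m : ℝ) + 1)
  have hε0 (m : ℕ) : 0 < ε m := by positivity
  have hε1 (m : ℕ) : ε m ≤ 1 := by
    simp only [ε]
    rw [div_le_one (by positivity)]
    linarith [m.cast_nonneg (α := ℝ)]
  have hχc : HasCompactSupport (χ : E → ℝ) := χ.hasCompactSupport
  have hχ : ContDiff ℝ ∞ (χ : E → ℝ) := χ.contDiff
  have hχm (m : ℕ) : ContDiff ℝ ∞ fun x => χ (ε m • x) := hχ.comp (contDiff_const_smul _)
  have hcs (m : ℕ) : HasCompactSupport fun x => χ (ε m • x) * f x :=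
    (hχc.comp_smul (hε0 m).ne').mul_right
  let F (m : ℕ) : 𝓢(E, ℝ) := (hcs m).toSchwartzMap ((hχm m).mul (f.smooth ⊤))
  refine mem_closure_of_tendsto (f := F) (b := atTop) ?_ (.of_forall hcs)
  let w : E → ℝ := fun x => 1 - χ x
  have hw : ContDiff ℝ ∞ w := contDiff_const.sub hχ
  have hwb (i : ℕ) : ∃ C, ∀ x, ‖iteratedFDeriv ℝ i w x‖ ≤ C := by
    obtain ⟨C, hC⟩ := ((hχ.of_le (by exact_mod_cast le_top : ((i : ℕ∞) : WithTop ℕ∞) ≤ ∞)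
      ).continuous_iteratedFDeriv').bounded_above_of_compact_support (hχc.iteratedFDeriv i)
    refine ⟨‖iteratedFDeriv ℝ i (fun _ : E => (1 : ℝ)) 0‖ + C, fun x => ?_⟩
    have h : iteratedFDeriv ℝ i w x =
        iteratedFDeriv ℝ i (fun _ : E => (1 : ℝ)) x - iteratedFDeriv ℝ i χ x :=
      iteratedFDeriv_sub_apply contDiffAt_const
        (hχ.of_le (by exact_mod_cast le_top)).contDiffAt
    rw [h]
    refine (norm_sub_le _ _).trans (add_le_add ?_ (hC x))
    rcases i with _ | i
    · simp
    · simp [iteratedFDeriv_const_of_ne]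
  choose C hC using hwb
  have hC0 (i : ℕ) : 0 ≤ C i := (norm_nonneg _).trans (hC i 0)
  have hFw (m : ℕ) : ((F m - f : 𝓢(E, ℝ)) : E → ℝ) = fun x => -(w (ε m • x) * f x) := by
    ext x
    change χ (ε m • x) * f x - f x = _
    simp only [w]
    ring
  have key (k n m : ℕ) : SchwartzMap.seminorm ℝ k n (F m - f) ≤
      ε m * ∑ i ∈ Finset.range (n + 1),
        (n.choose i : ℝ) * C i * SchwartzMap.seminorm ℝ (k + 1) (n - i) f := by
    have hnn : 0 ≤ ∑ i ∈ Finset.range (n + 1),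
        (n.choose i : ℝ) * C i * SchwartzMap.seminorm ℝ (k + 1) (n - i) f :=
      Finset.sum_nonneg fun i _ =>
        mul_nonneg (mul_nonneg (Nat.cast_nonneg _) (hC0 i)) (apply_nonneg _ _)
    refine SchwartzMap.seminorm_le_bound ℝ k n _ (mul_nonneg (hε0 m).le hnn) fun x => ?_
    rcases lt_or_ge ‖ε m • x‖ 1 with hx | hx
    · have hz : ((F m - f : 𝓢(E, ℝ)) : E → ℝ) =ᶠ[𝓝 x] fun _ => 0 := by
        have ho : IsOpen {y : E | ‖ε m • y‖ < 1} := isOpen_lt (by fun_prop) continuous_const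
        filter_upwards [ho.mem_nhds hx] with y hy
        have h1 : χ (ε m • y) = 1 := χ.one_of_mem_closedBall (by
          simpa [χ] using (le_of_lt hy))
        rw [hFw]
        simp [w, h1]
      have h0 : iteratedFDeriv ℝ n (F m - f : 𝓢(E, ℝ)) x = 0 := by
        rw [(hz.iteratedFDeriv ℝ n).eq_of_nhds]
        simp
      rw [h0, norm_zero, mul_zero]
      exact mul_nonneg (hε0 m).le hnn
    · have hx' : 1 ≤ ε m * ‖x‖ := by
        simpa [norm_smul, abs_of_pos (hε0 m)] using hx
      have hwm : ContDiff ℝ ∞ fun x => w (ε m • x) := hw.comp (contDiff_const_smul _)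
      have hle : ‖iteratedFDeriv ℝ n (F m - f : 𝓢(E, ℝ)) x‖ ≤ ∑ i ∈ Finset.range (n + 1),
          (n.choose i : ℝ) * C i * ‖iteratedFDeriv ℝ (n - i) f x‖ := by
        rw [hFw]
        have hneg : iteratedFDeriv ℝ n (fun x => -(w (ε m • x) * f x)) x =
            -iteratedFDeriv ℝ n (fun x => w (ε m • x) * f x) x := by
          rw [← iteratedFDeriv_neg_apply]; rfl
        rw [hneg, norm_neg]
        refine (norm_iteratedFDeriv_mul_le hwm (f.smooth ⊤) x
          (by exact_mod_cast le_top)).trans ?_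
        gcongr with i hi
        rw [iteratedFDeriv_comp_const_smul (ε m) (hw.of_le (by exact_mod_cast le_top)), norm_smul,
          norm_pow, Real.norm_of_nonneg (hε0 m).le]
        exact (mul_le_of_le_one_left (norm_nonneg _)
          (pow_le_one₀ (hε0 m).le (hε1 m))).trans (hC i _)
      calc ‖x‖ ^ k * ‖iteratedFDeriv ℝ n (F m - f : 𝓢(E, ℝ)) x‖
          ≤ (ε m * ‖x‖) * (‖x‖ ^ k * ∑ i ∈ Finset.range (n + 1),
            (n.choose i : ℝ) * C i * ‖iteratedFDeriv ℝ (n - i) f x‖) := by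
            refine (mul_le_mul_of_nonneg_left hle (by positivity)).trans
              (le_mul_of_one_le_left (mul_nonneg (by positivity) ?_) hx')
            exact (norm_nonneg _).trans hle
        _ = ε m * ∑ i ∈ Finset.range (n + 1), (n.choose i : ℝ) * C i *
            (‖x‖ ^ (k + 1) * ‖iteratedFDeriv ℝ (n - i) f x‖) := by
            simp only [Finset.mul_sum]
            refine Finset.sum_congr rfl fun i _ => ?_
            ring
        _ ≤ _ := by
            have := (hε0 m).le
            gcongr with i hi
            · exact mul_nonneg (Nat.cast_nonneg _) (hC0 i)
            · exact SchwartzMap.le_seminorm ℝ (k + 1) (n - i) f x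
  rw [(schwartz_withSeminorms ℝ E ℝ).tendsto_nhds F f]
  rintro ⟨k, n⟩ δ hδ
  have hlim : Tendsto (fun m => ε m * ∑ i ∈ Finset.range (n + 1),
      (n.choose i : ℝ) * C i * SchwartzMap.seminorm ℝ (k + 1) (n - i) f) atTop (𝓝 0) := by
    rw [← zero_mul]
    exact (tendsto_one_div_add_atTop_nhds_zero_nat (𝕜 := ℝ)).mul_const _
  filter_upwards [hlim.eventually_lt_const hδ] with m hm
  exact (key k n m).trans_lt hm

variable [FiniteDimensional ℝ E] [MeasurableSpace E] [BorelSpace E]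

theorem SchwartzMap.map_convolution_of_translation_invariant (μ : Measure E)
    [IsFiniteMeasureOnCompacts μ] [μ.IsAddLeftInvariant] (T : 𝓢(E, ℝ) →L[ℝ] ℝ)
    (hT : ∀ (h : E) (f : 𝓢(E, ℝ)), T (f.compSubConstCLM ℝ h) = T f)
    {f g u : 𝓢(E, ℝ)} (hf : HasCompactSupport f) (hg : HasCompactSupport g)
    (hu : (u : E → ℝ) = f ⋆[ContinuousLinearMap.lsmul ℝ ℝ, μ] g) :
    T u = (∫ x, f x ∂μ) * T g := by
  have hK : IsCompact (tsupport f + tsupport g) := hf.isCompact.add hg.isCompact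
  set K := tsupport f + tsupport g
  have := isCompact_iff_compactSpace.mp hK
  obtain ⟨N, L, hL⟩ := exists_eq_comp_jetOn T K
  have huK : u ∈ supportedIn K := by
    intro x hx
    by_contra h
    refine hx ?_
    have h' : x ∈ Function.support (f ⋆[ContinuousLinearMap.lsmul ℝ ℝ, μ] g) := hu ▸ h
    exact Set.add_subset_add (subset_tsupport _) (subset_tsupport _)
      (support_convolution_subset _ h')
  have hgK (y : E) (hy : f y ≠ 0) : g.compSubConstCLM ℝ y ∈ supportedIn K := by
    intro x hx
    by_contra h
    exact hx ⟨y, subset_tsupport _ hy, x - y, subset_tsupport _ h, by simp⟩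
  have hint : Integrable (fun y => f y • jetOn K N (g.compSubConstCLM ℝ y)) μ :=
    (f.continuous.smul (continuous_jetOn_translate K N g)).integrable_of_hasCompactSupport
      hf.smul_right
  have hjet : jetOn K N u = ∫ y, f y • jetOn K N (g.compSubConstCLM ℝ y) ∂μ := by
    refine JetSpace.ext fun n x => ?_
    have h1 := (JetSpace.evalCLM n x).integral_comp_comm hint
    have h2 := congrFun (iteratedFDeriv_convolution_lsmul_right (μ := μ)
      (f.continuous.locallyIntegrable) hg (g.smooth ⊤) n) x
    rw [← hu] at h2
    refine h2.trans (Eq.trans ?_ h1)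
    refine integral_congr_ae (.of_forall fun y => ?_)
    exact congrArg (fun v : E [×n]→L[ℝ] ℝ => f y • v)
      (iteratedFDeriv_comp_sub (𝕜 := ℝ) (f := g) n y (x : E)).symm
  rw [hL u huK, hjet, ← L.integral_comp_comm hint, ← integral_mul_const]
  refine integral_congr_ae (.of_forall fun y => ?_)
  by_cases hy : f y = 0
  · simp [hy]
  · simp [← hL _ (hgK y hy), hT]

theorem SchwartzMap.exists_eq_mul_integral_of_translation_invariant (μ : Measure E)
    [μ.IsAddHaarMeasure] (T : 𝓢(E, ℝ) →L[ℝ] ℝ)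
    (hT : ∀ (h : E) (f : 𝓢(E, ℝ)), T (f.compSubConstCLM ℝ h) = T f) :
    ∃ a : ℝ, ∀ f : 𝓢(E, ℝ), T f = a * ∫ x, f x ∂μ := by
  obtain ⟨g, hgc, hg⟩ : ∃ g : 𝓢(E, ℝ), HasCompactSupport g ∧ ∫ x, g x ∂μ = 1 := by
    let χ : ContDiffBump (0 : E) := ⟨1, 2, one_pos, one_lt_two⟩
    exact ⟨χ.hasCompactSupport_normed.toSchwartzMap (f := χ.normed μ) χ.contDiff_normed,
      χ.hasCompactSupport_normed, χ.integral_normed⟩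
  refine ⟨T g, fun f => ?_⟩
  suffices h : (T : 𝓢(E, ℝ) → ℝ) = fun f => T g * integralCLM ℝ μ f from congrFun h f
  refine Continuous.ext_on dense_hasCompactSupport T.continuous
    ((integralCLM ℝ μ).continuous.const_mul (T g)) fun f (hf : HasCompactSupport f) => ?_
  obtain ⟨u, hu⟩ : ∃ u : 𝓢(E, ℝ), (u : E → ℝ) = f ⋆[ContinuousLinearMap.lsmul ℝ ℝ, μ] g :=
    ⟨(HasCompactSupport.convolution _ hf hgc).toSchwartzMap
      (hgc.contDiff_convolution_right _ f.continuous.locallyIntegrable (g.smooth ⊤)), rfl⟩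
  have hu' : (u : E → ℝ) = g ⋆[ContinuousLinearMap.lsmul ℝ ℝ, μ] f := by
    ext x
    rw [hu, convolution_lsmul_swap]
    simp only [MeasureTheory.convolution, ContinuousLinearMap.lsmul_apply, smul_eq_mul, mul_comm]
  have h1 := map_convolution_of_translation_invariant μ T hT hf hgc hu
  have h2 := map_convolution_of_translation_invariant μ T hT hgc hf hu'
  rw [hg, one_mul] at h2
  rw [← h2, h1, mul_comm]
  rfl

end InvariantDistributions

theorem stmt11 (d : ℕ) (hd : 1 ≤ d)
    (T : SchwartzMap (EuclideanSpace ℝ (Fin d)) ℝ →L[ℝ] ℝ)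
    (hT : ∀ (h : EuclideanSpace ℝ (Fin d))
        (φ ψ : SchwartzMap (EuclideanSpace ℝ (Fin d)) ℝ),
      (∀ z, ψ z = φ (z - h)) → T ψ = T φ) :
    ∃ a : ℝ, ∀ φ : SchwartzMap (EuclideanSpace ℝ (Fin d)) ℝ,
      T φ = a * ∫ z : EuclideanSpace ℝ (Fin d), φ z :=
  exists_eq_mul_integral_of_translation_invariant volume T
    fun h f => hT h f _ fun _ => rfl
end
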